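/- arXiv:2301.11346 — 3 statements merged into one kernel-verified Lean document; each statement's English description precedes it below -/
import Mathlib

section
/- Let C and D be k-coalgebras, M a (C,D)-bicomodule with coactions λ_M : M → C ⊗ M and ρ_M : M → M ⊗ D, and N a (D,C)-bicomodule with coactions λ_N : N → D ⊗ N and ρ_N : N → N ⊗ C. Let coHH_0(M □_D N, C) be the k-submodule of M ⊗ N consisting of all x with (ρ_M ⊗ id_N)(x) = (id_M ⊗ λ_N)(x) in M ⊗ D ⊗ N and (id_M ⊗ ρ_N)(x) = t((λ_M ⊗ id_N)(x)) in M ⊗ N ⊗ C, where t : C ⊗ M ⊗ N → M ⊗ N ⊗ C moves the first factor to the last; define coHH_0(N □_C M, D) ⊆ N ⊗ M analogously. Then the twist isomorphism M ⊗ N ≅ N ⊗ M, m ⊗ n ↦ n ⊗ m, restricts to a k-linear isomorphism θ : coHH_0(M □_D N, C) ≅ coHH_0(N □_C M, D). -/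
open TensorProduct LinearMap

noncomputable section

/-- A right `C`-comodule structure on a `k`-module `M`. -/
structure RightCoaction (k C M : Type*) [CommRing k]
    [AddCommGroup C] [Module k C] [Coalgebra k C]
    [AddCommGroup M] [Module k M] where
  ρ : M →ₗ[k] M ⊗[k] C
  coassoc : TensorProduct.assoc k M C C ∘ₗ ρ.rTensor C ∘ₗ ρ
      = LinearMap.lTensor M (Coalgebra.comul (R := k) (A := C)) ∘ₗ ρ
  counit : LinearMap.lTensor M (Coalgebra.counit (R := k) (A := C)) ∘ₗ ρ
      = (TensorProduct.rid k M).symm.toLinearMap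

/-- A left `C`-comodule structure on a `k`-module `M`. -/
structure LeftCoaction (k C M : Type*) [CommRing k]
    [AddCommGroup C] [Module k C] [Coalgebra k C]
    [AddCommGroup M] [Module k M] where
  lam : M →ₗ[k] C ⊗[k] M
  coassoc : TensorProduct.assoc k C C M ∘ₗ
        LinearMap.rTensor M (Coalgebra.comul (R := k) (A := C)) ∘ₗ lam
      = LinearMap.lTensor C lam ∘ₗ lam
  counit : LinearMap.rTensor M (Coalgebra.counit (R := k) (A := C)) ∘ₗ lam
      = (TensorProduct.lid k M).symm.toLinearMap

/-- A `(C,D)`-bicomodule structure on `M`. -/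
structure Bicomodule (k C D M : Type*) [CommRing k]
    [AddCommGroup C] [Module k C] [Coalgebra k C]
    [AddCommGroup D] [Module k D] [Coalgebra k D]
    [AddCommGroup M] [Module k M] where
  left : LeftCoaction k C M
  right : RightCoaction k D M
  compat : TensorProduct.assoc k C M D ∘ₗ LinearMap.rTensor D left.lam ∘ₗ right.ρ
      = LinearMap.lTensor C right.ρ ∘ₗ left.lam

variable (k C D M N : Type*) [CommRing k] [IsSemisimpleRing k]
  [AddCommGroup C] [Module k C] [Coalgebra k C]
  [AddCommGroup D] [Module k D] [Coalgebra k D]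
  [AddCommGroup M] [Module k M]
  [AddCommGroup N] [Module k N]

/-- `coHH_0(M □_D N, C)`, the submodule of `M ⊗ N` cut out by the cotensor condition over `D`
and the coHochschild condition `(id_M ⊗ ρ_N)(x) = t((λ_M ⊗ id_N)(x))` for the outer
`C`-coactions. -/
def coHH0cotensor (BM : Bicomodule k C D M) (BN : Bicomodule k D C N) :
    Submodule k (M ⊗[k] N) :=
  LinearMap.ker
      ((TensorProduct.assoc k M D N).toLinearMap ∘ₗ LinearMap.rTensor N BM.right.ρ
        - LinearMap.lTensor M BN.left.lam) ⊓
    LinearMap.ker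
      (LinearMap.lTensor M BN.right.ρ
        - (TensorProduct.assoc k M N C).toLinearMap
            ∘ₗ (TensorProduct.comm k C (M ⊗[k] N)).toLinearMap
            ∘ₗ (TensorProduct.assoc k C M N).toLinearMap
            ∘ₗ LinearMap.rTensor N BM.left.lam)

section Rotation

variable {R P Q S : Type*} [CommRing R] [AddCommGroup P] [Module R P]
  [AddCommGroup Q] [Module R Q] [AddCommGroup S] [Module R S]

/-- The cyclic rotation `p ⊗ (q ⊗ s) ↦ q ⊗ (s ⊗ p)`. -/
def tensorRotate (R P Q S : Type*) [CommRing R] [AddCommGroup P] [Module R P]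
    [AddCommGroup Q] [Module R Q] [AddCommGroup S] [Module R S] :
    P ⊗[R] (Q ⊗[R] S) ≃ₗ[R] Q ⊗[R] (S ⊗[R] P) :=
  TensorProduct.comm R P (Q ⊗[R] S) ≪≫ₗ TensorProduct.assoc R Q S P

theorem tensorRotate_lTensor (f : Q →ₗ[R] Q ⊗[R] S) (x : P ⊗[R] Q) :
    tensorRotate R P Q S (f.lTensor P x) =
      TensorProduct.assoc R Q S P (f.rTensor P (TensorProduct.comm R P Q x)) := by
  induction x with
  | zero => simp
  | add x y hx hy => simp only [map_add, hx, hy]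
  | tmul p q => rfl

theorem tensorRotate_rTensor (f : P →ₗ[R] S ⊗[R] P) (x : P ⊗[R] Q) :
    tensorRotate R P Q S (TensorProduct.assoc R P Q S (TensorProduct.comm R S (P ⊗[R] Q)
        (TensorProduct.assoc R S P Q (f.rTensor Q x)))) =
      f.lTensor Q (TensorProduct.comm R P Q x) := by
  induction x with
  | zero => simp
  | add x y hx hy => simp only [map_add, hx, hy]
  | tmul p q =>
    simp only [LinearMap.rTensor_tmul, LinearMap.lTensor_tmul, TensorProduct.comm_tmul]
    induction f p with
    | zero => simp
    | add u v hu hv => simp only [TensorProduct.add_tmul, TensorProduct.tmul_add, map_add, hu, hv]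
    | tmul s p => rfl

end Rotation

set_option linter.unusedSectionVars false in
theorem mem_coHH0cotensor_iff (BM : Bicomodule k C D M) (BN : Bicomodule k D C N)
    (x : M ⊗[k] N) :
    x ∈ coHH0cotensor k C D M N BM BN ↔
      TensorProduct.assoc k M D N (BM.right.ρ.rTensor N x) = BN.left.lam.lTensor M x ∧
      BN.right.ρ.lTensor M x = TensorProduct.assoc k M N C (TensorProduct.comm k C (M ⊗[k] N)
        (TensorProduct.assoc k C M N (BM.left.lam.rTensor N x))) := by
  simp [coHH0cotensor, sub_eq_zero]

theorem comm_mem_coHH0cotensor_iff (BM : Bicomodule k C D M) (BN : Bicomodule k D C N)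
    (x : M ⊗[k] N) :
    TensorProduct.comm k M N x ∈ coHH0cotensor k D C N M BN BM ↔
      x ∈ coHH0cotensor k C D M N BM BN := by
  have hρ := tensorRotate_lTensor BM.right.ρ (TensorProduct.comm k M N x)
  have hlam := tensorRotate_rTensor BN.left.lam (TensorProduct.comm k M N x)
  rw [TensorProduct.comm_comm] at hρ hlam
  rw [mem_coHH0cotensor_iff, mem_coHH0cotensor_iff, ← tensorRotate_lTensor, ← tensorRotate_rTensor,
    ← hρ, ← hlam, EmbeddingLike.apply_eq_iff_eq, EmbeddingLike.apply_eq_iff_eq, and_comm]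

/-- The twist `m ⊗ n ↦ n ⊗ m` restricts to a `k`-linear isomorphism
`θ : coHH_0(M □_D N, C) ≅ coHH_0(N □_C M, D)`. -/
theorem coHH0_shadow_iso (BM : Bicomodule k C D M) (BN : Bicomodule k D C N) :
    (∀ x : M ⊗[k] N,
        x ∈ coHH0cotensor k C D M N BM BN ↔
          TensorProduct.comm k M N x ∈ coHH0cotensor k D C N M BN BM) ∧
      ∃ θ : ↥(coHH0cotensor k C D M N BM BN) ≃ₗ[k] ↥(coHH0cotensor k D C N M BN BM),
        ∀ x : ↥(coHH0cotensor k C D M N BM BN),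
          (θ x : N ⊗[k] M) = TensorProduct.comm k M N (x : M ⊗[k] N) := by
  refine ⟨fun x => (comm_mem_coHH0cotensor_iff k C D M N BM BN x).symm,
    (TensorProduct.comm k M N).ofSubmodules _ _ ?_, fun x => rfl⟩
  ext y
  rw [Submodule.map_equiv_eq_comap_symm, Submodule.mem_comap,
    ← comm_mem_coHH0cotensor_iff k C D M N BM BN]
  simp

end
end

section
/- Let C and D be k-coalgebras, M a (C,D)-bicomodule, N a (D,C)-bicomodule and P a (C,C)-bicomodule. Inside the triple tensor products M ⊗ N ⊗ P, P ⊗ M ⊗ N, N ⊗ P ⊗ M, etc., consider the submodules coHH_0((M □_D N) □_C P, C), coHH_0(P □_C (M □_D N), C), coHH_0((P □_C M) □_D N, C), coHH_0(M □_D (N □_C P), C), coHH_0((N □_C P) □_C M, D) and coHH_0(N □_C (P □_C M), D), each cut out by the two cotensor equalizer conditions on adjacent factors together with the coHH_0 condition ρ(x) = t(λ(x)) for the two outer coactions. The shadow maps θ and the associators ⟨a⟩ between these submodules are the restrictions of the canonical block-permutation and reassociation isomorphisms of tensor products. Then the hexagon commutes: the composite ⟨a⟩ ∘ θ : coHH_0((M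 □_D N) □_C P, C) → coHH_0((P □_C M) □_D N, C) (through coHH_0(P □_C (M □_D N), C)) equals the composite θ ∘ ⟨a⟩ ∘ θ ∘ ⟨a⟩ through coHH_0(M □_D (N □_C P), C), coHH_0((N □_C P) □_C M, D) and coHH_0(N □_C (P □_C M), D); on elements, both composites are the restriction of the permutation x ⊗ y ⊗ z ↦ z ⊗ x ⊗ y on M ⊗ N ⊗ P. -/
open TensorProduct LinearMap

noncomputable section

variable (k C D M N P : Type*) [CommRing k] [IsSemisimpleRing k]
  [AddCommGroup C] [Module k C] [Coalgebra k C]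
  [AddCommGroup D] [Module k D] [Coalgebra k D]
  [AddCommGroup M] [Module k M]
  [AddCommGroup N] [Module k N]
  [AddCommGroup P] [Module k P]

variable (BM : Bicomodule k C D M) (BN : Bicomodule k D C N) (BP : Bicomodule k C C P)

/-- Membership in `coHH_0((M □_D N) □_C P, C) ⊆ (M ⊗ N) ⊗ P`: the two cotensor equalizer
conditions on adjacent factors together with the coHH₀ condition for the two outer
`C`-coactions. -/
def SrcCond (x : (M ⊗[k] N) ⊗[k] P) : Prop :=
  (LinearMap.rTensor P (LinearMap.rTensor N BM.right.ρ) x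
      = LinearMap.rTensor P
          ((TensorProduct.assoc k M D N).symm.toLinearMap ∘ₗ
            LinearMap.lTensor M BN.left.lam) x) ∧
  ((TensorProduct.assoc k (M ⊗[k] N) C P).toLinearMap
        (LinearMap.rTensor P
          ((TensorProduct.assoc k M N C).symm.toLinearMap ∘ₗ
            LinearMap.lTensor M BN.right.ρ) x)
      = LinearMap.lTensor (M ⊗[k] N) BP.left.lam x) ∧
  ((TensorProduct.assoc k (M ⊗[k] N) P C).symm
        (LinearMap.lTensor (M ⊗[k] N) BP.right.ρ x)
      = TensorProduct.comm k C ((M ⊗[k] N) ⊗[k] P)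
          (TensorProduct.assoc k C (M ⊗[k] N) P
            (LinearMap.rTensor P
              ((TensorProduct.assoc k C M N).toLinearMap ∘ₗ
                LinearMap.rTensor N BM.left.lam) x)))

/-- Membership in `coHH_0((P □_C M) □_D N, C) ⊆ (P ⊗ M) ⊗ N`. -/
def TgtCond (y : (P ⊗[k] M) ⊗[k] N) : Prop :=
  (LinearMap.rTensor N (LinearMap.rTensor M BP.right.ρ) y
      = LinearMap.rTensor N
          ((TensorProduct.assoc k P C M).symm.toLinearMap ∘ₗ
            LinearMap.lTensor P BM.left.lam) y) ∧
  ((TensorProduct.assoc k (P ⊗[k] M) D N).toLinearMap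
        (LinearMap.rTensor N
          ((TensorProduct.assoc k P M D).symm.toLinearMap ∘ₗ
            LinearMap.lTensor P BM.right.ρ) y)
      = LinearMap.lTensor (P ⊗[k] M) BN.left.lam y) ∧
  ((TensorProduct.assoc k (P ⊗[k] M) N C).symm
        (LinearMap.lTensor (P ⊗[k] M) BN.right.ρ y)
      = TensorProduct.comm k C ((P ⊗[k] M) ⊗[k] N)
          (TensorProduct.assoc k C (P ⊗[k] M) N
            (LinearMap.rTensor N
              ((TensorProduct.assoc k C P M).toLinearMap ∘ₗ
                LinearMap.rTensor M BP.left.lam) y)))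

/-- The composite `⟨a⟩ ∘ θ` through `coHH_0(P □_C (M □_D N), C)`. -/
def comp₁ : (M ⊗[k] N) ⊗[k] P →ₗ[k] (P ⊗[k] M) ⊗[k] N :=
  (TensorProduct.assoc k P M N).symm.toLinearMap ∘ₗ
    (TensorProduct.comm k (M ⊗[k] N) P).toLinearMap

/-- The composite `θ ∘ ⟨a⟩ ∘ θ ∘ ⟨a⟩` through `coHH_0(M □_D (N □_C P), C)`,
`coHH_0((N □_C P) □_C M, D)` and `coHH_0(N □_C (P □_C M), D)`. -/
def comp₂ : (M ⊗[k] N) ⊗[k] P →ₗ[k] (P ⊗[k] M) ⊗[k] N :=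
  (TensorProduct.comm k N (P ⊗[k] M)).toLinearMap ∘ₗ
    (TensorProduct.assoc k N P M).toLinearMap ∘ₗ
      (TensorProduct.comm k M (N ⊗[k] P)).toLinearMap ∘ₗ
        (TensorProduct.assoc k M N P).toLinearMap

/-- The block permutation `((x ⊗ y) ⊗ z) ⊗ c ↦ ((z ⊗ c) ⊗ x) ⊗ y`. -/
def rotateOuter (k X Y Z W : Type*) [CommRing k] [AddCommGroup X] [Module k X]
    [AddCommGroup Y] [Module k Y] [AddCommGroup Z] [Module k Z] [AddCommGroup W] [Module k W] :
    ((X ⊗[k] Y) ⊗[k] Z) ⊗[k] W →ₗ[k] ((Z ⊗[k] W) ⊗[k] X) ⊗[k] Y :=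
  comp₁ k X Y (Z ⊗[k] W) ∘ₗ (TensorProduct.assoc k (X ⊗[k] Y) Z W).toLinearMap

/-- The block permutation `((x ⊗ d) ⊗ y) ⊗ z ↦ (z ⊗ x) ⊗ (d ⊗ y)`. -/
def rotateLeft (k X W Y Z : Type*) [CommRing k] [AddCommGroup X] [Module k X]
    [AddCommGroup Y] [Module k Y] [AddCommGroup Z] [Module k Z] [AddCommGroup W] [Module k W] :
    ((X ⊗[k] W) ⊗[k] Y) ⊗[k] Z →ₗ[k] (Z ⊗[k] X) ⊗[k] (W ⊗[k] Y) :=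
  comp₁ k X (W ⊗[k] Y) Z ∘ₗ
    LinearMap.rTensor Z (TensorProduct.assoc k X W Y).toLinearMap

/-- The block permutation `(x ⊗ y) ⊗ (c ⊗ z) ↦ ((z ⊗ x) ⊗ y) ⊗ c`. -/
def rotateRight (k X Y W Z : Type*) [CommRing k] [AddCommGroup X] [Module k X]
    [AddCommGroup Y] [Module k Y] [AddCommGroup Z] [Module k Z] [AddCommGroup W] [Module k W] :
    (X ⊗[k] Y) ⊗[k] (W ⊗[k] Z) →ₗ[k] ((Z ⊗[k] X) ⊗[k] Y) ⊗[k] W :=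
  LinearMap.rTensor W (comp₁ k X Y Z) ∘ₗ
    (TensorProduct.assoc k (X ⊗[k] Y) Z W).symm.toLinearMap ∘ₗ
      LinearMap.lTensor (X ⊗[k] Y) (TensorProduct.comm k W Z).toLinearMap

section Rotation

variable {k X Y Z W : Type*} [CommRing k] [AddCommGroup X] [Module k X]
  [AddCommGroup Y] [Module k Y] [AddCommGroup Z] [Module k Z] [AddCommGroup W] [Module k W]

theorem comp₁_tmul (x : X) (y : Y) (z : Z) :
    comp₁ k X Y Z ((x ⊗ₜ y) ⊗ₜ z) = (z ⊗ₜ x) ⊗ₜ y := rfl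

theorem comp₁_eq_comp₂ : comp₁ k X Y Z = comp₂ k X Y Z :=
  TensorProduct.ext_threefold fun _ _ _ => rfl

theorem rTensor_rTensor_comp₁ (f : Z →ₗ[k] Z ⊗[k] W) (t : (X ⊗[k] Y) ⊗[k] Z) :
    LinearMap.rTensor Y (LinearMap.rTensor X f) (comp₁ k X Y Z t)
      = rotateOuter k X Y Z W ((TensorProduct.assoc k (X ⊗[k] Y) Z W).symm
          (LinearMap.lTensor (X ⊗[k] Y) f t)) := by
  induction t using TensorProduct.induction_on with
  | zero => simp only [map_zero]
  | add a b ha hb => simp only [map_add, ha, hb]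
  | tmul s z =>
    induction s using TensorProduct.induction_on with
    | zero => simp only [zero_tmul, map_zero]
    | add a b ha hb => simp only [add_tmul, map_add, ha, hb]
    | tmul x y =>
      simp only [comp₁_tmul, rTensor_tmul, lTensor_tmul]
      induction f z using TensorProduct.induction_on with
      | zero => simp only [zero_tmul, tmul_zero, map_zero]
      | add a b ha hb => simp only [add_tmul, tmul_add, map_add, ha, hb]
      | tmul a b => rfl

theorem rTensor_assoc_symm_lTensor_comp₁ (f : X →ₗ[k] W ⊗[k] X) (t : (X ⊗[k] Y) ⊗[k] Z) :
    LinearMap.rTensor Y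
        ((TensorProduct.assoc k Z W X).symm.toLinearMap ∘ₗ LinearMap.lTensor Z f) (comp₁ k X Y Z t)
      = rotateOuter k X Y Z W (TensorProduct.comm k W ((X ⊗[k] Y) ⊗[k] Z)
          (TensorProduct.assoc k W (X ⊗[k] Y) Z
            (LinearMap.rTensor Z
              ((TensorProduct.assoc k W X Y).toLinearMap ∘ₗ LinearMap.rTensor Y f) t))) := by
  induction t using TensorProduct.induction_on with
  | zero => simp only [map_zero]
  | add a b ha hb => simp only [map_add, ha, hb]
  | tmul s z =>
    induction s using TensorProduct.induction_on with
    | zero => simp only [zero_tmul, map_zero]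
    | add a b ha hb => simp only [add_tmul, map_add, ha, hb]
    | tmul x y =>
      simp only [comp₁_tmul, rTensor_tmul, lTensor_tmul, LinearMap.comp_apply,
        LinearEquiv.coe_coe]
      induction f x using TensorProduct.induction_on with
      | zero => simp only [zero_tmul, tmul_zero, map_zero]
      | add a b ha hb => simp only [add_tmul, tmul_add, map_add, ha, hb]
      | tmul a b => rfl

theorem assoc_rTensor_lTensor_comp₁ (f : X →ₗ[k] X ⊗[k] W) (t : (X ⊗[k] Y) ⊗[k] Z) :
    (TensorProduct.assoc k (Z ⊗[k] X) W Y).toLinearMap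
        (LinearMap.rTensor Y
          ((TensorProduct.assoc k Z X W).symm.toLinearMap ∘ₗ LinearMap.lTensor Z f) (comp₁ k X Y Z t))
      = rotateLeft k X W Y Z (LinearMap.rTensor Z (LinearMap.rTensor Y f) t) := by
  induction t using TensorProduct.induction_on with
  | zero => simp only [map_zero]
  | add a b ha hb => simp only [map_add, ha, hb]
  | tmul s z =>
    induction s using TensorProduct.induction_on with
    | zero => simp only [zero_tmul, map_zero]
    | add a b ha hb => simp only [add_tmul, map_add, ha, hb]
    | tmul x y =>
      simp only [comp₁_tmul, rTensor_tmul, lTensor_tmul, LinearMap.comp_apply,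
        LinearEquiv.coe_coe]
      induction f x using TensorProduct.induction_on with
      | zero => simp only [zero_tmul, tmul_zero, map_zero]
      | add a b ha hb => simp only [add_tmul, tmul_add, map_add, ha, hb]
      | tmul a b => rfl

theorem lTensor_comp₁ (f : Y →ₗ[k] W ⊗[k] Y) (t : (X ⊗[k] Y) ⊗[k] Z) :
    LinearMap.lTensor (Z ⊗[k] X) f (comp₁ k X Y Z t)
      = rotateLeft k X W Y Z (LinearMap.rTensor Z
          ((TensorProduct.assoc k X W Y).symm.toLinearMap ∘ₗ LinearMap.lTensor X f) t) := by
  induction t using TensorProduct.induction_on with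
  | zero => simp only [map_zero]
  | add a b ha hb => simp only [map_add, ha, hb]
  | tmul s z =>
    induction s using TensorProduct.induction_on with
    | zero => simp only [zero_tmul, map_zero]
    | add a b ha hb => simp only [add_tmul, map_add, ha, hb]
    | tmul x y =>
      simp only [comp₁_tmul, rTensor_tmul, lTensor_tmul, LinearMap.comp_apply,
        LinearEquiv.coe_coe]
      induction f y using TensorProduct.induction_on with
      | zero => simp only [zero_tmul, tmul_zero, map_zero]
      | add a b ha hb => simp only [add_tmul, tmul_add, map_add, ha, hb]
      | tmul a b => rfl

theorem assoc_symm_lTensor_comp₁ (f : Y →ₗ[k] Y ⊗[k] W) (t : (X ⊗[k] Y) ⊗[k] Z) :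
    (TensorProduct.assoc k (Z ⊗[k] X) Y W).symm (LinearMap.lTensor (Z ⊗[k] X) f (comp₁ k X Y Z t))
      = rotateRight k X Y W Z ((TensorProduct.assoc k (X ⊗[k] Y) W Z).toLinearMap
          (LinearMap.rTensor Z
            ((TensorProduct.assoc k X Y W).symm.toLinearMap ∘ₗ LinearMap.lTensor X f) t)) := by
  induction t using TensorProduct.induction_on with
  | zero => simp only [map_zero]
  | add a b ha hb => simp only [map_add, ha, hb]
  | tmul s z =>
    induction s using TensorProduct.induction_on with
    | zero => simp only [zero_tmul, map_zero]
    | add a b ha hb => simp only [add_tmul, map_add, ha, hb]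
    | tmul x y =>
      simp only [comp₁_tmul, rTensor_tmul, lTensor_tmul, LinearMap.comp_apply,
        LinearEquiv.coe_coe]
      induction f y using TensorProduct.induction_on with
      | zero => simp only [zero_tmul, tmul_zero, map_zero]
      | add a b ha hb => simp only [add_tmul, tmul_add, map_add, ha, hb]
      | tmul a b => rfl

theorem comm_assoc_rTensor_comp₁ (f : Z →ₗ[k] W ⊗[k] Z) (t : (X ⊗[k] Y) ⊗[k] Z) :
    TensorProduct.comm k W ((Z ⊗[k] X) ⊗[k] Y)
        (TensorProduct.assoc k W (Z ⊗[k] X) Y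
          (LinearMap.rTensor Y
            ((TensorProduct.assoc k W Z X).toLinearMap ∘ₗ LinearMap.rTensor X f) (comp₁ k X Y Z t)))
      = rotateRight k X Y W Z (LinearMap.lTensor (X ⊗[k] Y) f t) := by
  induction t using TensorProduct.induction_on with
  | zero => simp only [map_zero]
  | add a b ha hb => simp only [map_add, ha, hb]
  | tmul s z =>
    induction s using TensorProduct.induction_on with
    | zero => simp only [zero_tmul, map_zero]
    | add a b ha hb => simp only [add_tmul, map_add, ha, hb]
    | tmul x y =>
      simp only [comp₁_tmul, rTensor_tmul, lTensor_tmul, LinearMap.comp_apply,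
        LinearEquiv.coe_coe]
      induction f z using TensorProduct.induction_on with
      | zero => simp only [zero_tmul, tmul_zero, map_zero]
      | add a b ha hb => simp only [add_tmul, tmul_add, map_add, ha, hb]
      | tmul a b => rfl

end Rotation

/-- The hexagon axiom for the shadow `coHH₀`: both composites agree on
`coHH_0((M □_D N) □_C P, C)`, land in `coHH_0((P □_C M) □_D N, C)`, and are the restriction
of the permutation `x ⊗ y ⊗ z ↦ z ⊗ x ⊗ y`. -/
theorem coHH0_shadow_hexagon :
    (∀ x : (M ⊗[k] N) ⊗[k] P, SrcCond k C D M N P BM BN BP x →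
        TgtCond k C D M N P BM BN BP (comp₁ k M N P x) ∧
          comp₁ k M N P x = comp₂ k M N P x) ∧
      ∀ (m : M) (n : N) (p : P),
        comp₁ k M N P ((m ⊗ₜ[k] n) ⊗ₜ[k] p) = (p ⊗ₜ[k] m) ⊗ₜ[k] n ∧
          comp₂ k M N P ((m ⊗ₜ[k] n) ⊗ₜ[k] p) = (p ⊗ₜ[k] m) ⊗ₜ[k] n := by
  refine ⟨fun x ⟨hMN, hNP, hPM⟩ => ⟨⟨?_, ?_, ?_⟩, congrArg (· x) comp₁_eq_comp₂⟩,
    fun _ _ _ => ⟨rfl, rfl⟩⟩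
  · rw [rTensor_rTensor_comp₁, rTensor_assoc_symm_lTensor_comp₁, hPM]
  · rw [assoc_rTensor_lTensor_comp₁, lTensor_comp₁, hMN]
  · rw [assoc_symm_lTensor_comp₁, comm_assoc_rTensor_comp₁, hNP]

end
end

section
/- Let C be a k-coalgebra and P a (C,C)-bicomodule with coactions λ : P → C ⊗ P and ρ : P → P ⊗ C. Consider coHH_0(P □_C C, C) ⊆ P ⊗ C, the submodule of x with (ρ ⊗ id_C)(x) = (id_P ⊗ Δ_C)(x) and (id_P ⊗ Δ_C)(x) = t((λ ⊗ id_C)(x)) (the outer coactions being λ on the left and Δ_C on the right), and coHH_0(C □_C P, C) ⊆ C ⊗ P defined analogously. Then: (i) id_P ⊗ ε_C restricts to a k-linear isomorphism ⟨r⟩ : coHH_0(P □_C C, C) ≅ coHH_0(P, C); (ii) ε_C ⊗ id_P restricts to a k-linear isomorphism ⟨ℓ⟩ : coHH_0(C □_C P, C) ≅ coHH_0(P, C); (iii) letting θ be the restriction of the twist P ⊗ C ≅ C ⊗ P, one has ⟨ℓ⟩ ∘ θ = ⟨r⟩. -/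
open TensorProduct LinearMap

noncomputable section

variable (k C P : Type*) [CommRing k] [IsSemisimpleRing k]
  [AddCommGroup C] [Module k C] [Coalgebra k C]
  [AddCommGroup P] [Module k P]

variable (BP : Bicomodule k C C P)

/-- `coHH_0(P □_C C, C) ⊆ P ⊗ C`. -/
def coHH0PC : Submodule k (P ⊗[k] C) :=
  LinearMap.ker
      (LinearMap.rTensor C BP.right.ρ
        - (TensorProduct.assoc k P C C).symm.toLinearMap ∘ₗ
            LinearMap.lTensor P (Coalgebra.comul (R := k) (A := C))) ⊓
    LinearMap.ker
      ((TensorProduct.assoc k P C C).symm.toLinearMap ∘ₗ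
          LinearMap.lTensor P (Coalgebra.comul (R := k) (A := C))
        - (TensorProduct.comm k C (P ⊗[k] C)).toLinearMap ∘ₗ
            (TensorProduct.assoc k C P C).toLinearMap ∘ₗ
              LinearMap.rTensor C BP.left.lam)

/-- `coHH_0(C □_C P, C) ⊆ C ⊗ P`. -/
def coHH0CP : Submodule k (C ⊗[k] P) :=
  LinearMap.ker
      ((TensorProduct.assoc k C C P).toLinearMap ∘ₗ
          LinearMap.rTensor P (Coalgebra.comul (R := k) (A := C))
        - LinearMap.lTensor C BP.left.lam) ⊓
    LinearMap.ker
      ((TensorProduct.assoc k C P C).symm.toLinearMap ∘ₗ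
          LinearMap.lTensor C BP.right.ρ
        - (TensorProduct.comm k C (C ⊗[k] P)).toLinearMap ∘ₗ
            (TensorProduct.assoc k C C P).toLinearMap ∘ₗ
              LinearMap.rTensor P (Coalgebra.comul (R := k) (A := C)))

/-- `coHH_0(P, C) ⊆ P`. -/
def coHH0P : Submodule k P :=
  LinearMap.ker
    (BP.right.ρ - (TensorProduct.comm k C P).toLinearMap ∘ₗ BP.left.lam)

section

variable {k C P : Type*} [CommRing k] [AddCommGroup C] [Module k C] [Coalgebra k C]
  [AddCommGroup P] [Module k P] {BP : Bicomodule k C C P}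

theorem RightCoaction.coassoc_apply (R : RightCoaction k C P) (p : P) :
    (TensorProduct.assoc k P C C).symm (LinearMap.lTensor P Coalgebra.comul (R.ρ p))
      = LinearMap.rTensor C R.ρ (R.ρ p) := by
  rw [LinearEquiv.symm_apply_eq]
  exact (LinearMap.congr_fun R.coassoc p).symm

theorem LeftCoaction.coassoc_apply (L : LeftCoaction k C P) (p : P) :
    TensorProduct.assoc k C C P (LinearMap.rTensor P Coalgebra.comul (L.lam p))
      = LinearMap.lTensor C L.lam (L.lam p) :=
  LinearMap.congr_fun L.coassoc p

theorem RightCoaction.rid_counit_apply (R : RightCoaction k C P) (p : P) :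
    TensorProduct.rid k P (LinearMap.lTensor P Coalgebra.counit (R.ρ p)) = p := by
  rw [← LinearEquiv.eq_symm_apply]
  exact LinearMap.congr_fun R.counit p

theorem LeftCoaction.lid_counit_apply (L : LeftCoaction k C P) (p : P) :
    TensorProduct.lid k P (LinearMap.rTensor P Coalgebra.counit (L.lam p)) = p := by
  rw [← LinearEquiv.eq_symm_apply]
  exact LinearMap.congr_fun L.counit p

/-- Right counitality of `Δ` on `P ⊗ C`. -/
theorem rid_counit_assoc_symm_comul (x : P ⊗[k] C) :
    TensorProduct.rid k (P ⊗[k] C) (LinearMap.lTensor (P ⊗[k] C) Coalgebra.counit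
      ((TensorProduct.assoc k P C C).symm (LinearMap.lTensor P Coalgebra.comul x))) = x := by
  have nat (p : P) (z : C ⊗[k] C) :
      TensorProduct.rid k (P ⊗[k] C) (LinearMap.lTensor (P ⊗[k] C) Coalgebra.counit
        ((TensorProduct.assoc k P C C).symm (p ⊗ₜ z)))
      = p ⊗ₜ TensorProduct.rid k C (LinearMap.lTensor C Coalgebra.counit z) := by
    induction z with
    | zero => simp
    | tmul a b => simp
    | add a b ha hb => simp only [TensorProduct.tmul_add, map_add, ha, hb]
  induction x with
  | zero => simp
  | tmul p c => simp [nat]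
  | add a b ha hb => simp only [map_add, ha, hb]

/-- Middle counitality of `Δ` on `P ⊗ C`. -/
theorem rTensor_rid_counit_assoc_symm_comul (x : P ⊗[k] C) :
    LinearMap.rTensor C ((TensorProduct.rid k P).toLinearMap ∘ₗ
        LinearMap.lTensor P Coalgebra.counit)
      ((TensorProduct.assoc k P C C).symm (LinearMap.lTensor P Coalgebra.comul x)) = x := by
  have nat (p : P) (z : C ⊗[k] C) :
      LinearMap.rTensor C ((TensorProduct.rid k P).toLinearMap ∘ₗ
          LinearMap.lTensor P Coalgebra.counit)
        ((TensorProduct.assoc k P C C).symm (p ⊗ₜ z))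
      = p ⊗ₜ TensorProduct.lid k C (LinearMap.rTensor C Coalgebra.counit z) := by
    induction z with
    | zero => simp
    | tmul a b => simp [TensorProduct.smul_tmul]
    | add a b ha hb => simp only [TensorProduct.tmul_add, map_add, ha, hb]
  induction x with
  | zero => simp
  | tmul p c => simp [nat]
  | add a b ha hb => simp only [map_add, ha, hb]

/-- Left counitality of `Δ` on `C ⊗ P`. -/
theorem lid_counit_assoc_comul (y : C ⊗[k] P) :
    TensorProduct.lid k (C ⊗[k] P) (LinearMap.rTensor (C ⊗[k] P) Coalgebra.counit
      (TensorProduct.assoc k C C P (LinearMap.rTensor P Coalgebra.comul y))) = y := by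
  have nat (p : P) (z : C ⊗[k] C) :
      TensorProduct.lid k (C ⊗[k] P) (LinearMap.rTensor (C ⊗[k] P) Coalgebra.counit
        (TensorProduct.assoc k C C P (z ⊗ₜ p)))
      = TensorProduct.lid k C (LinearMap.rTensor C Coalgebra.counit z) ⊗ₜ p := by
    induction z with
    | zero => simp
    | tmul a b => simp [TensorProduct.smul_tmul']
    | add a b ha hb => simp only [TensorProduct.add_tmul, map_add, ha, hb]
  induction y with
  | zero => simp
  | tmul c p => simp [nat]
  | add a b ha hb => simp only [map_add, ha, hb]

/-- Middle counitality of `Δ` on `C ⊗ P`. -/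
theorem lTensor_lid_counit_assoc_comul (y : C ⊗[k] P) :
    LinearMap.lTensor C ((TensorProduct.lid k P).toLinearMap ∘ₗ
        LinearMap.rTensor P Coalgebra.counit)
      (TensorProduct.assoc k C C P (LinearMap.rTensor P Coalgebra.comul y)) = y := by
  have nat (p : P) (z : C ⊗[k] C) :
      LinearMap.lTensor C ((TensorProduct.lid k P).toLinearMap ∘ₗ
          LinearMap.rTensor P Coalgebra.counit)
        (TensorProduct.assoc k C C P (z ⊗ₜ p))
      = TensorProduct.rid k C (LinearMap.lTensor C Coalgebra.counit z) ⊗ₜ p := by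
    induction z with
    | zero => simp
    | tmul a b => simp [TensorProduct.smul_tmul]
    | add a b ha hb => simp only [TensorProduct.add_tmul, map_add, ha, hb]
  induction y with
  | zero => simp
  | tmul c p => simp [nat]
  | add a b ha hb => simp only [map_add, ha, hb]

/-- An element of `P □_C C` is the coaction of its image under `id ⊗ ε`. -/
theorem RightCoaction.rho_rid_counit_of_mem_cotensor (R : RightCoaction k C P) {x : P ⊗[k] C}
    (h : LinearMap.rTensor C R.ρ x
      = (TensorProduct.assoc k P C C).symm (LinearMap.lTensor P Coalgebra.comul x)) :
    R.ρ (TensorProduct.rid k P (LinearMap.lTensor P Coalgebra.counit x)) = x := by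
  have nat (z : P ⊗[k] C) :
      TensorProduct.rid k (P ⊗[k] C) (LinearMap.lTensor (P ⊗[k] C) Coalgebra.counit
        (LinearMap.rTensor C R.ρ z))
      = R.ρ (TensorProduct.rid k P (LinearMap.lTensor P Coalgebra.counit z)) := by
    induction z with
    | zero => simp
    | tmul a b => simp
    | add a b ha hb => simp only [map_add, ha, hb]
  rw [← nat, h, rid_counit_assoc_symm_comul]

/-- An element of `C □_C P` is the coaction of its image under `ε ⊗ id`. -/
theorem LeftCoaction.lam_lid_counit_of_mem_cotensor (L : LeftCoaction k C P) {y : C ⊗[k] P}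
    (h : TensorProduct.assoc k C C P (LinearMap.rTensor P Coalgebra.comul y)
      = LinearMap.lTensor C L.lam y) :
    L.lam (TensorProduct.lid k P (LinearMap.rTensor P Coalgebra.counit y)) = y := by
  have nat (z : C ⊗[k] P) :
      TensorProduct.lid k (C ⊗[k] P) (LinearMap.rTensor (C ⊗[k] P) Coalgebra.counit
        (LinearMap.lTensor C L.lam z))
      = L.lam (TensorProduct.lid k P (LinearMap.rTensor P Coalgebra.counit z)) := by
    induction z with
    | zero => simp
    | tmul a b => simp
    | add a b ha hb => simp only [map_add, ha, hb]
  rw [← nat, ← h, lid_counit_assoc_comul]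

theorem rTensor_rid_counit_comm_assoc_lam (L : LeftCoaction k C P) (x : P ⊗[k] C) :
    LinearMap.rTensor C ((TensorProduct.rid k P).toLinearMap ∘ₗ
        LinearMap.lTensor P Coalgebra.counit)
      (TensorProduct.comm k C (P ⊗[k] C)
        (TensorProduct.assoc k C P C (LinearMap.rTensor C L.lam x)))
    = TensorProduct.comm k C P (L.lam
        (TensorProduct.rid k P (LinearMap.lTensor P Coalgebra.counit x))) := by
  have nat (z : C ⊗[k] P) (c : C) :
      LinearMap.rTensor C ((TensorProduct.rid k P).toLinearMap ∘ₗ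
          LinearMap.lTensor P Coalgebra.counit)
        (TensorProduct.comm k C (P ⊗[k] C) (TensorProduct.assoc k C P C (z ⊗ₜ c)))
      = Coalgebra.counit (R := k) c • TensorProduct.comm k C P z := by
    induction z with
    | zero => simp
    | tmul a b => simp [TensorProduct.smul_tmul']
    | add a b ha hb => simp only [TensorProduct.add_tmul, map_add, ha, hb, smul_add]
  induction x with
  | zero => simp
  | tmul p c => simp [nat]
  | add a b ha hb => simp only [map_add, ha, hb]

theorem rTensor_lid_counit_assoc_symm_rho (R : RightCoaction k C P) (y : C ⊗[k] P) :
    LinearMap.rTensor C ((TensorProduct.lid k P).toLinearMap ∘ₗ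
        LinearMap.rTensor P Coalgebra.counit)
      ((TensorProduct.assoc k C P C).symm (LinearMap.lTensor C R.ρ y))
    = R.ρ (TensorProduct.lid k P (LinearMap.rTensor P Coalgebra.counit y)) := by
  have nat (c : C) (z : P ⊗[k] C) :
      LinearMap.rTensor C ((TensorProduct.lid k P).toLinearMap ∘ₗ
          LinearMap.rTensor P Coalgebra.counit)
        ((TensorProduct.assoc k C P C).symm (c ⊗ₜ z))
      = Coalgebra.counit (R := k) c • z := by
    induction z with
    | zero => simp
    | tmul a b => simp [TensorProduct.smul_tmul']
    | add a b ha hb => simp only [TensorProduct.tmul_add, map_add, ha, hb, smul_add]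
  induction y with
  | zero => simp
  | tmul c p => simp [nat]
  | add a b ha hb => simp only [map_add, ha, hb]

theorem mem_coHH0PC {x : P ⊗[k] C} : x ∈ coHH0PC k C P BP ↔
    LinearMap.rTensor C BP.right.ρ x
        = (TensorProduct.assoc k P C C).symm (LinearMap.lTensor P Coalgebra.comul x) ∧
      (TensorProduct.assoc k P C C).symm (LinearMap.lTensor P Coalgebra.comul x)
        = TensorProduct.comm k C (P ⊗[k] C)
            (TensorProduct.assoc k C P C (LinearMap.rTensor C BP.left.lam x)) := by
  simp [coHH0PC, sub_eq_zero]

theorem mem_coHH0CP {y : C ⊗[k] P} : y ∈ coHH0CP k C P BP ↔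
    TensorProduct.assoc k C C P (LinearMap.rTensor P Coalgebra.comul y)
        = LinearMap.lTensor C BP.left.lam y ∧
      (TensorProduct.assoc k C P C).symm (LinearMap.lTensor C BP.right.ρ y)
        = TensorProduct.comm k C (C ⊗[k] P)
            (TensorProduct.assoc k C C P (LinearMap.rTensor P Coalgebra.comul y)) := by
  simp [coHH0CP, sub_eq_zero]

theorem mem_coHH0P {p : P} : p ∈ coHH0P k C P BP ↔
    BP.right.ρ p = TensorProduct.comm k C P (BP.left.lam p) := by
  simp [coHH0P, sub_eq_zero]

theorem rho_mem_coHH0PC {p : P} (hp : p ∈ coHH0P k C P BP) :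
    BP.right.ρ p ∈ coHH0PC k C P BP := by
  have compat : TensorProduct.assoc k C P C (LinearMap.rTensor C BP.left.lam (BP.right.ρ p))
      = LinearMap.lTensor C BP.right.ρ (BP.left.lam p) := LinearMap.congr_fun BP.compat p
  rw [mem_coHH0PC, BP.right.coassoc_apply, compat, ← rTensor_comm, ← mem_coHH0P.1 hp]
  exact ⟨rfl, rfl⟩

theorem lam_mem_coHH0CP {p : P} (hp : p ∈ coHH0P k C P BP) :
    BP.left.lam p ∈ coHH0CP k C P BP := by
  have compat : TensorProduct.assoc k C P C (LinearMap.rTensor C BP.left.lam (BP.right.ρ p))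
      = LinearMap.lTensor C BP.right.ρ (BP.left.lam p) := LinearMap.congr_fun BP.compat p
  rw [mem_coHH0CP, BP.left.coassoc_apply, ← compat, LinearEquiv.symm_apply_apply,
    ← rTensor_comm, ← mem_coHH0P.1 hp]
  exact ⟨rfl, rfl⟩

theorem rho_rid_counit {x : P ⊗[k] C} (hx : x ∈ coHH0PC k C P BP) :
    BP.right.ρ (TensorProduct.rid k P (LinearMap.lTensor P Coalgebra.counit x)) = x :=
  BP.right.rho_rid_counit_of_mem_cotensor (mem_coHH0PC.1 hx).1

theorem lam_lid_counit {y : C ⊗[k] P} (hy : y ∈ coHH0CP k C P BP) :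
    BP.left.lam (TensorProduct.lid k P (LinearMap.rTensor P Coalgebra.counit y)) = y :=
  BP.left.lam_lid_counit_of_mem_cotensor (mem_coHH0CP.1 hy).1

theorem rid_counit_mem_coHH0P {x : P ⊗[k] C} (hx : x ∈ coHH0PC k C P BP) :
    TensorProduct.rid k P (LinearMap.lTensor P Coalgebra.counit x) ∈ coHH0P k C P BP := by
  rw [mem_coHH0P, rho_rid_counit hx, ← rTensor_rid_counit_comm_assoc_lam,
    ← (mem_coHH0PC.1 hx).2, rTensor_rid_counit_assoc_symm_comul]

theorem lid_counit_mem_coHH0P {y : C ⊗[k] P} (hy : y ∈ coHH0CP k C P BP) :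
    TensorProduct.lid k P (LinearMap.rTensor P Coalgebra.counit y) ∈ coHH0P k C P BP := by
  rw [mem_coHH0P, lam_lid_counit hy, ← rTensor_lid_counit_assoc_symm_rho,
    (mem_coHH0CP.1 hy).2, rTensor_comm, lTensor_lid_counit_assoc_comul]

end

/-- The unit coherence axiom for the shadow `coHH₀`:
`id_P ⊗ ε_C` and `ε_C ⊗ id_P` restrict to isomorphisms
`⟨r⟩ : coHH_0(P □_C C, C) ≅ coHH_0(P, C)` and `⟨ℓ⟩ : coHH_0(C □_C P, C) ≅ coHH_0(P, C)`,
and `⟨ℓ⟩ ∘ θ = ⟨r⟩` for the twist `θ`. -/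
theorem coHH0_shadow_unit :
    (∃ r : ↥(coHH0PC k C P BP) ≃ₗ[k] ↥(coHH0P k C P BP),
        ∀ x : ↥(coHH0PC k C P BP),
          (r x : P) = TensorProduct.rid k P
            (LinearMap.lTensor P (Coalgebra.counit (R := k) (A := C)) (x : P ⊗[k] C))) ∧
    (∃ l : ↥(coHH0CP k C P BP) ≃ₗ[k] ↥(coHH0P k C P BP),
        ∀ x : ↥(coHH0CP k C P BP),
          (l x : P) = TensorProduct.lid k P
            (LinearMap.rTensor P (Coalgebra.counit (R := k) (A := C)) (x : C ⊗[k] P))) ∧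
    (∀ x : P ⊗[k] C, x ∈ coHH0PC k C P BP →
        TensorProduct.comm k P C x ∈ coHH0CP k C P BP ∧
          TensorProduct.lid k P
              (LinearMap.rTensor P (Coalgebra.counit (R := k) (A := C))
                (TensorProduct.comm k P C x))
            = TensorProduct.rid k P
                (LinearMap.lTensor P (Coalgebra.counit (R := k) (A := C)) x)) := by
  refine ⟨⟨LinearEquiv.ofLinearMap
      (((TensorProduct.rid k P).toLinearMap ∘ₗ
        LinearMap.lTensor P Coalgebra.counit).restrict fun _ hx => rid_counit_mem_coHH0P hx)
      (BP.right.ρ.restrict fun _ hp => rho_mem_coHH0PC hp)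
      (LinearMap.ext fun p => Subtype.ext (BP.right.rid_counit_apply p))
      (LinearMap.ext fun x => Subtype.ext (rho_rid_counit x.2)), fun _ => rfl⟩,
    ⟨LinearEquiv.ofLinearMap
      (((TensorProduct.lid k P).toLinearMap ∘ₗ
        LinearMap.rTensor P Coalgebra.counit).restrict fun _ hy => lid_counit_mem_coHH0P hy)
      (BP.left.lam.restrict fun _ hp => lam_mem_coHH0CP hp)
      (LinearMap.ext fun p => Subtype.ext (BP.left.lid_counit_apply p))
      (LinearMap.ext fun y => Subtype.ext (lam_lid_counit y.2)), fun _ => rfl⟩,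
    fun x hx => ?_⟩
  have hp := rid_counit_mem_coHH0P hx
  have comm_eq : TensorProduct.comm k P C x = BP.left.lam
      (TensorProduct.rid k P (LinearMap.lTensor P Coalgebra.counit x)) := by
    rw [← TensorProduct.comm_symm, LinearEquiv.symm_apply_eq, ← mem_coHH0P.1 hp,
      rho_rid_counit hx]
  rw [comm_eq]
  exact ⟨lam_mem_coHH0CP hp, BP.left.lid_counit_apply _⟩

end
end
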